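/- Fix n ∈ ℕ, a finite alphabet 𝕏, a PMF P_n on 𝕏^n, ρ > 0, and a key rate R > 0 with nR ∈ ℕ (key uniform on 𝕂 with |𝕂| = 2^{nR}). Define E_n(R,ρ) = sup over encryption functions f_n of (1/n)·log₂ of the minimum over attack strategies G of E[G(X^n|Y)^ρ], and E_{n,l}(R,ρ) = min over length functions L_n on 𝕏^n of (1/n)·log₂ E[(min{2^{L_n(X^n)}, 2^{nR}})^ρ]. Then |E_{n,l}(R,ρ) − E_n(R,ρ)| ≤ (1/n)·log₂(2^{2ρ}·c_n^ρ·(2+ρ)), where c_n = ∑_{i=1}^{|𝕏|^n} 1/i. -/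

import Mathlib

open Finset in
lemma aux_prefix (φ : ℕ → ℝ) (hφ : Monotone φ) : ∀ (t : ℕ) (S : Finset ℕ), S.card = t →
    (∀ s ∈ S, 1 ≤ s) → ∑ i ∈ range t, φ (i + 1) ≤ ∑ s ∈ S, φ s := by
  intro t
  induction t with
  | zero => intro S hS _; rw [Finset.card_eq_zero] at hS; simp [hS]
  | succ t ih =>
    intro S hS h1
    have hne : S.Nonempty := by rw [← Finset.card_pos]; omega
    have hm := S.max'_mem hne
    have hle : t + 1 ≤ S.max' hne := by
      have hsub : S ⊆ Finset.Icc 1 (S.max' hne) := by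
        intro s hs
        exact Finset.mem_Icc.2 ⟨h1 s hs, S.le_max' s hs⟩
      have := Finset.card_le_card hsub
      simp at this
      omega
    rw [Finset.sum_range_succ, ← Finset.sum_erase_add S φ hm]
    refine add_le_add (ih _ ?_ ?_) (hφ hle)
    · rw [Finset.card_erase_of_mem hm]; omega
    · intro s hs; exact h1 s (Finset.mem_of_mem_erase hs)

open Finset in
lemma aux_rearr (φ : ℕ → ℝ) (hφ : Monotone φ) (q : ℕ → ℝ) (hq : Antitone q) (hq0 : ∀ i, 0 ≤ q i)
    (K : ℕ) (g : ℕ → ℕ) (hg1 : ∀ i, 1 ≤ g i) (hg : ∀ i < K, ∀ j < K, g i = g j → i = j) :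
    ∑ i ∈ range K, q i * φ (i + 1) ≤ ∑ i ∈ range K, q i * φ (g i) := by
  have hD : ∀ t ≤ K, 0 ≤ ∑ i ∈ range t, (φ (g i) - φ (i + 1)) := by
    intro t ht
    have hinj : Set.InjOn g (range t : Finset ℕ) := by
      intro i hi j hj hij
      simp at hi hj
      exact hg i (by omega) j (by omega) hij
    have := aux_prefix φ hφ t ((range t).image g) (by rw [card_image_of_injOn hinj]; simp)
      (by intro s hs; obtain ⟨i, _, rfl⟩ := mem_image.1 hs; exact hg1 i)
    rw [sum_image hinj] at this
    rw [sum_sub_distrib]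
    linarith
  have key : ∀ t ≤ K, q t * ∑ i ∈ range t, (φ (g i) - φ (i + 1))
      ≤ ∑ i ∈ range t, q i * (φ (g i) - φ (i + 1)) := by
    intro t
    induction t with
    | zero => simp
    | succ t ih =>
      intro ht
      have h1 := ih (by omega)
      have h2 := hD (t + 1) ht
      have h3 : q (t + 1) * ∑ i ∈ range (t + 1), (φ (g i) - φ (i + 1)) ≤
          q t * ∑ i ∈ range (t + 1), (φ (g i) - φ (i + 1)) :=
        mul_le_mul_of_nonneg_right (hq (Nat.le_succ t)) h2
      refine h3.trans ?_
      rw [sum_range_succ, sum_range_succ, mul_add]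
      linarith
  have h1 := key K le_rfl
  have h2 := mul_nonneg (hq0 K) (hD K le_rfl)
  have h3 : ∑ i ∈ range K, q i * (φ (g i) - φ (i + 1)) =
    ∑ i ∈ range K, q i * φ (g i) - ∑ i ∈ range K, q i * φ (i + 1) := by
    rw [← sum_sub_distrib]; exact sum_congr rfl fun i _ => by ring
  linarith

open Finset in
lemma aux_blocks (F : ℕ → ℝ) (K N : ℕ) :
    ∑ i ∈ range (N * K), F i = ∑ j ∈ range N, ∑ r ∈ range K, F (j * K + r) := by
  induction N with
  | zero => simp
  | succ N ih => rw [sum_range_succ, ← ih, Nat.succ_mul, sum_range_add]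

open Finset in
lemma aux_power (ρ : ℝ) (hρ : 0 < ρ) (K : ℕ) :
    (K : ℝ) ^ (ρ + 1) ≤ (1 + ρ) * ∑ r ∈ range K, ((r + 1 : ℕ) : ℝ) ^ ρ := by
  induction K with
  | zero => simp [Real.zero_rpow (by linarith : ρ + 1 ≠ 0)]
  | succ K ih =>
    rw [sum_range_succ, mul_add]
    have hK : (0 : ℝ) < ((K + 1 : ℕ) : ℝ) := by positivity
    have hK1 : (1 : ℝ) ≤ ((K + 1 : ℕ) : ℝ) := by push_cast; linarith [(Nat.cast_nonneg K : (0:ℝ) ≤ K)]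
    have hb := one_add_mul_self_le_rpow_one_add (s := -1 / ((K + 1 : ℕ) : ℝ))
      (by rw [le_div_iff₀ hK]; linarith) (p := ρ + 1) (by linarith)
    have e1 : 1 + -1 / ((K + 1 : ℕ) : ℝ) = (K : ℝ) / ((K + 1 : ℕ) : ℝ) := by
      field_simp; push_cast; ring
    rw [e1, Real.div_rpow (by positivity) (by positivity), le_div_iff₀ (by positivity)] at hb
    have e2 : ((K + 1 : ℕ) : ℝ) ^ (ρ + 1) = ((K + 1 : ℕ) : ℝ) ^ ρ * ((K + 1 : ℕ) : ℝ) := by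
      rw [Real.rpow_add hK, Real.rpow_one]
    have e3 : (1 + (ρ + 1) * (-1 / ((K + 1 : ℕ) : ℝ))) * ((K + 1 : ℕ) : ℝ) ^ (ρ + 1) =
      ((K + 1 : ℕ) : ℝ) ^ (ρ + 1) - (1 + ρ) * ((K + 1 : ℕ) : ℝ) ^ ρ := by
      rw [e2]; field_simp; ring
    rw [e3] at hb
    linarith

open Finset in
lemma aux_compare (ρ : ℝ) (hρ : 0 < ρ) (q : ℕ → ℝ) (hq : Antitone q) (hq0 : ∀ i, 0 ≤ q i)
    (K N : ℕ) :
    ∑ j ∈ range N, ∑ r ∈ range K, q (j * K + r) * ((min (j * K + r + 1) K : ℕ) : ℝ) ^ ρ ≤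
    (2 + ρ) * ∑ j ∈ range N, ∑ r ∈ range K, q (j * K + r) * ((r + 1 : ℕ) : ℝ) ^ ρ := by
  cases N with
  | zero => simp
  | succ N =>
    set T : ℕ → ℝ := fun j => ∑ r ∈ range K, q (j * K + r) * ((r + 1 : ℕ) : ℝ) ^ ρ with hT
    set M : ℕ → ℝ := fun j =>
      ∑ r ∈ range K, q (j * K + r) * ((min (j * K + r + 1) K : ℕ) : ℝ) ^ ρ with hM
    have hT0 : ∀ j, 0 ≤ T j := fun j => sum_nonneg fun r _ => mul_nonneg (hq0 _) (by positivity)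
    have h0 : M 0 = T 0 := by
      refine sum_congr rfl fun r hr => ?_
      have : r + 1 ≤ K := by simpa using hr
      simp only [zero_mul, zero_add]
      rw [min_eq_left this]
    have hs : ∀ j, M (j + 1) ≤ (1 + ρ) * T j := by
      intro j
      have h1 : M (j + 1) ≤ ∑ r ∈ range K, q ((j + 1) * K) * (K : ℝ) ^ ρ := by
        refine sum_le_sum fun r _ => ?_
        refine mul_le_mul (hq (by omega)) ?_ (by positivity) (hq0 _)
        exact Real.rpow_le_rpow (by positivity) (by exact_mod_cast min_le_right _ _) hρ.le
      have h2 : ∑ r ∈ range K, q ((j + 1) * K) * ((r + 1 : ℕ) : ℝ) ^ ρ ≤ T j := by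
        refine sum_le_sum fun r hr => ?_
        refine mul_le_mul_of_nonneg_right (hq ?_) (by positivity)
        have : r < K := by simpa using hr
        rw [Nat.succ_mul]; omega
      rw [← mul_sum] at h2
      rw [sum_const, card_range, nsmul_eq_mul] at h1
      have h3 := mul_le_mul_of_nonneg_left (aux_power ρ hρ K) (hq0 ((j + 1) * K))
      rcases Nat.eq_zero_or_pos K with hK | hK
      · subst hK; simp [hM, hT]
      have hK' : (0 : ℝ) < K := by exact_mod_cast hK
      rw [Real.rpow_add hK', Real.rpow_one] at h3
      nlinarith
    calc ∑ j ∈ range (N + 1), M j = ∑ j ∈ range N, M (j + 1) + M 0 := sum_range_succ' _ _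
      _ ≤ ∑ j ∈ range N, (1 + ρ) * T j + T 0 := by
          rw [h0]; gcongr with j _; exact hs j
      _ = (1 + ρ) * ∑ j ∈ range N, T j + T 0 := by rw [mul_sum]
      _ ≤ (1 + ρ) * ∑ j ∈ range (N + 1), T j + ∑ j ∈ range (N + 1), T j := by
          have a1 : ∑ j ∈ range N, T j ≤ ∑ j ∈ range (N + 1), T j := by
            rw [sum_range_succ]; linarith [hT0 N]
          have a2 : T 0 ≤ ∑ j ∈ range (N + 1), T j :=
            single_le_sum (fun j _ => hT0 j) (by simp)
          have := mul_le_mul_of_nonneg_left a1 (by linarith : 0 ≤ 1 + ρ)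
          linarith
      _ = _ := by ring

lemma aux_sort {W : Type} [Fintype W] (h : W → ℝ) :
    ∃ e : Fin (Fintype.card W) ≃ W, Monotone (h ∘ e) := by
  let e0 := (Fintype.equivFin W).symm
  exact ⟨(Tuple.sort (h ∘ e0)).trans e0, Tuple.monotone_sort (h ∘ e0)⟩

lemma aux_attack {W : Type} [Fintype W] (k : ℕ)
    (f : W × Fin (2 ^ k) → W × Fin (2 ^ k)) (hf : ∀ u, Function.Injective fun x => f (x, u))
    (L : W → ℕ) (hL : ∑ x, (2 : ℝ) ^ (-(L x : ℤ)) ≤ 1) :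
    ∃ G : W × Fin (2 ^ k) → W → ℕ, ((∀ y, Function.Injective (G y)) ∧ ∀ y x, 1 ≤ G y x) ∧
      ∀ x u, G (f (x, u)) x ≤ 2 * min (2 ^ L x) (2 ^ k) := by
  classical
  obtain ⟨e, he⟩ := aux_sort (fun x => (L x : ℝ))
  set a : W → ℕ := fun x => (e.symm x : ℕ) with ha
  have hainj : Function.Injective a := fun x y h => e.symm.injective (Fin.ext h)
  have haL : ∀ x, a x + 1 ≤ 2 ^ L x := by
    intro x
    have h1 : ∑ j ∈ Finset.Iic (e.symm x), (2 : ℝ) ^ (-(L x : ℤ)) ≤ 1 := by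
      calc ∑ j ∈ Finset.Iic (e.symm x), (2 : ℝ) ^ (-(L x : ℤ))
          ≤ ∑ j ∈ Finset.Iic (e.symm x), (2 : ℝ) ^ (-(L (e j) : ℤ)) := by
            refine Finset.sum_le_sum fun j hj => ?_
            have := he (Finset.mem_Iic.1 hj)
            simp at this
            exact zpow_le_zpow_right₀ (by norm_num) (by omega)
        _ ≤ ∑ j, (2 : ℝ) ^ (-(L (e j) : ℤ)) :=
            Finset.sum_le_sum_of_subset_of_nonneg (Finset.subset_univ _)
              (fun _ _ _ => by positivity)
        _ = ∑ x, (2 : ℝ) ^ (-(L x : ℤ)) := e.sum_comp (fun x => (2 : ℝ) ^ (-(L x : ℤ)))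
        _ ≤ 1 := hL
    rw [Finset.sum_const, Fin.card_Iic, nsmul_eq_mul, zpow_neg, zpow_natCast,
      ← div_eq_mul_inv, div_le_one (by positivity)] at h1
    exact_mod_cast h1
  let b : W × Fin (2 ^ k) → W → ℕ := fun y x =>
    if h : ∃ u, f (x, u) = y then (h.choose : ℕ) else 2 ^ k
  have hb : ∀ y x, (∃ u, f (x, u) = y) → ∃ u : Fin (2 ^ k), b y x = u ∧ f (x, u) = y := by
    intro y x h
    refine ⟨h.choose, ?_, h.choose_spec⟩
    simp only [b, dif_pos h]
  refine ⟨fun y x => if (∃ u, f (x, u) = y) ∧ b y x ≤ a x then 2 * b y x + 1 else 2 * a x + 2,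
    ⟨?_, ?_⟩, ?_⟩
  · intro y x x' hxx
    simp only at hxx
    split_ifs at hxx with h1 h2 h2
    · obtain ⟨u, hu, hu'⟩ := hb y x h1.1
      obtain ⟨v, hv, hv'⟩ := hb y x' h2.1
      have : u = v := Fin.ext (by omega)
      subst this
      exact hf u (hu'.trans hv'.symm)
    · omega
    · omega
    · exact hainj (by omega)
  · intro y x; simp only; split_ifs <;> omega
  · intro x u
    obtain ⟨v, hv, hv'⟩ := hb (f (x, u)) x ⟨u, rfl⟩
    have h1 := haL x
    have h2 := v.2
    simp only
    rcases le_total (2 ^ L x) (2 ^ k) with h | h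
    · rw [min_eq_left h]; split_ifs <;> omega
    · rw [min_eq_right h]
      split_ifs with h3
      · omega
      · have : ¬ b (f (x, u)) x ≤ a x := fun h4 => h3 ⟨⟨u, rfl⟩, h4⟩
        omega

open Finset in
lemma aux_encrypt {W : Type} [Fintype W] (k : ℕ)
    (P : W → ℝ) (hP0 : ∀ x, 0 ≤ P x) (ρ : ℝ) (hρ : 0 < ρ) :
    ∃ (e : Fin (Fintype.card W) ≃ W) (f : W × Fin (2 ^ k) → W × Fin (2 ^ k)),
      (∀ u, Function.Injective fun x => f (x, u)) ∧
      ∀ G : W × Fin (2 ^ k) → W → ℕ, (∀ y, Function.Injective (G y)) → (∀ y x, 1 ≤ G y x) →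
        ∑ x, P x * ((min ((e.symm x : ℕ) + 1) (2 ^ k) : ℕ) : ℝ) ^ ρ ≤
        (2 + ρ) * ∑ x, ∑ u, P x * ((2 : ℝ) ^ k)⁻¹ * (G (f (x, u)) x : ℝ) ^ ρ := by
  classical
  set N := Fintype.card W with hN
  obtain ⟨e, he⟩ : ∃ e : Fin N ≃ W, Monotone ((fun x => - P x) ∘ e) :=
    aux_sort (fun x => - P x)
  set K := 2 ^ k with hK
  have hKpos : 0 < K := by positivity
  have : NeZero K := ⟨hKpos.ne'⟩
  let q : ℕ → ℝ := fun i => if h : i < N then P (e ⟨i, h⟩) else 0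
  have hq0 : ∀ i, 0 ≤ q i := by
    intro i; simp only [q]; split_ifs
    · exact hP0 _
    · exact le_rfl
  have hq : Antitone q := by
    intro i j hij
    simp only [q]
    split_ifs with h1 h2 h2
    · have := he (show (⟨i, h2⟩ : Fin N) ≤ ⟨j, h1⟩ from hij)
      simp at this
      exact this
    · omega
    · exact hP0 _
    · exact le_rfl
  have hsum : ∀ F : ℕ → ℝ, ∑ x, P x * F (e.symm x) =
      ∑ j ∈ range N, ∑ r ∈ range K, q (j * K + r) * F (j * K + r) := by
    intro F
    rw [← aux_blocks (fun i => q i * F i), ← e.sum_comp]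
    have h1 : ∑ i ∈ range (N * K), q i * F i = ∑ i ∈ range N, q i * F i := by
      symm
      refine sum_subset ?_ ?_
      · intro i hi
        simp only [mem_range] at hi ⊢
        exact lt_of_lt_of_le hi (Nat.le_mul_of_pos_right N hKpos)
      · intro i _ hi
        simp only [mem_range] at hi
        simp [q, hi]
    rw [h1, ← Fin.sum_univ_eq_sum_range (fun i => q i * F i) N]
    refine sum_congr rfl fun i _ => ?_
    simp [q]
  let blk : W → W := fun x =>
    e ⟨(e.symm x : ℕ) / K, lt_of_le_of_lt (Nat.div_le_self _ _) (e.symm x).2⟩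
  let off : W → Fin K := fun x => ⟨(e.symm x : ℕ) % K, Nat.mod_lt _ hKpos⟩
  refine ⟨e, fun p => (blk p.1, off p.1 + p.2), ?_, ?_⟩
  · intro u x x' h
    simp only [Prod.mk.injEq, blk, off, add_left_inj, e.injective.eq_iff, Fin.mk.injEq] at h
    apply e.symm.injective
    apply Fin.ext
    rw [← Nat.div_add_mod (e.symm x : ℕ) K, ← Nat.div_add_mod (e.symm x' : ℕ) K, h.1, h.2]
  · intro G hG hG1
    -- the ideal guessing cost
    have hTu : ∀ u : Fin K, ∑ x, P x * (((e.symm x : ℕ) % K + 1 : ℕ) : ℝ) ^ ρ ≤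
        ∑ x, P x * (G (blk x, u) x : ℝ) ^ ρ := by
      intro u
      let g : ℕ → ℕ := fun i => if h : i < N then G (blk (e ⟨i, h⟩), u) (e ⟨i, h⟩)
        else (∑ x, G (blk x, u) x) + 1 + i
      have hg : ∀ x, g (e.symm x) = G (blk x, u) x := by
        intro x; simp [g]
      have h1 := hsum (fun i => ((i % K + 1 : ℕ) : ℝ) ^ ρ)
      have h2 := hsum (fun i => (g i : ℝ) ^ ρ)
      simp only [hg] at h2
      rw [h1, h2]
      refine sum_le_sum fun j _ => ?_
      have h3 := aux_rearr (fun i => (i : ℝ) ^ ρ)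
        (fun a b hab => Real.rpow_le_rpow (by positivity) (by exact_mod_cast hab) hρ.le)
        (fun r => q (j * K + r)) (fun a b hab => hq (by omega)) (fun r => hq0 _) K
        (fun r => g (j * K + r)) ?_ ?_
      · refine le_trans (le_of_eq ?_) h3
        refine sum_congr rfl fun r hr => ?_
        have hr' : r < K := by simpa using hr
        have : (j * K + r) % K = r := by
          rw [Nat.add_comm, Nat.add_mul_mod_self_right, Nat.mod_eq_of_lt hr']
        simp only [this]
      · intro r
        simp only [g]
        split_ifs
        · exact hG1 _ _
        · omega
      · intro r hr s hs hrs
        have hdiv : ∀ t, t < K → (j * K + t) / K = j := by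
          intro t ht
          rw [Nat.add_comm, Nat.add_mul_div_right _ _ hKpos, Nat.div_eq_of_lt ht, zero_add]
        have hbd : ∀ x, G (blk x, u) x ≤ ∑ x, G (blk x, u) x := fun x =>
          single_le_sum (f := fun x => G (blk x, u) x) (fun _ _ => Nat.zero_le _) (mem_univ x)
        simp only [g] at hrs
        split_ifs at hrs with h4 h5 h5
        · have hb : blk (e ⟨j * K + r, h4⟩) = blk (e ⟨j * K + s, h5⟩) := by
            simp only [blk, Equiv.symm_apply_apply, hdiv r hr, hdiv s hs]
          rw [hb] at hrs
          have := e.injective (hG _ hrs)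
          simp at this
          exact this
        · have := hbd (e ⟨j * K + r, h4⟩); omega
        · have := hbd (e ⟨j * K + s, h5⟩); omega
        · omega
    have hE : ∑ x, ∑ u, P x * ((2 : ℝ) ^ k)⁻¹ * (G (blk x, off x + u) x : ℝ) ^ ρ =
        ((2 : ℝ) ^ k)⁻¹ * ∑ u : Fin K, ∑ x, P x * (G (blk x, u) x : ℝ) ^ ρ := by
      rw [sum_comm (s := (univ : Finset (Fin K))), mul_sum]
      refine sum_congr rfl fun x _ => ?_
      rw [mul_sum, ← Equiv.sum_comp (Equiv.addLeft (off x))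
        (fun u => ((2 : ℝ) ^ k)⁻¹ * (P x * (G (blk x, u) x : ℝ) ^ ρ))]
      refine sum_congr rfl fun u _ => ?_
      simp only [Equiv.coe_addLeft]
      ring
    have hT : ∑ x, P x * (((e.symm x : ℕ) % K + 1 : ℕ) : ℝ) ^ ρ ≤
        ∑ x, ∑ u, P x * ((2 : ℝ) ^ k)⁻¹ * (G (blk x, off x + u) x : ℝ) ^ ρ := by
      rw [hE]
      have h1 := sum_le_sum (s := (univ : Finset (Fin K))) fun u _ => hTu u
      rw [sum_const, card_univ, Fintype.card_fin, nsmul_eq_mul] at h1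
      have h2 : (K : ℝ) = 2 ^ k := by simp [hK]
      rw [h2] at h1
      rw [inv_mul_eq_div, le_div_iff₀ (by positivity)]
      linarith
    refine le_trans ?_ (mul_le_mul_of_nonneg_left hT (by linarith))
    have h1 := hsum (fun i => ((i % K + 1 : ℕ) : ℝ) ^ ρ)
    have h2 := hsum (fun i => ((min (i + 1) K : ℕ) : ℝ) ^ ρ)
    rw [h1, h2]
    refine le_trans (aux_compare ρ hρ q hq hq0 K N) (le_of_eq ?_)
    congr 1
    refine sum_congr rfl fun j _ => sum_congr rfl fun r hr => ?_
    have hr' : r < K := by simpa using hr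
    have : (j * K + r) % K = r := by
      rw [Nat.add_comm, Nat.add_mul_mod_self_right, Nat.mod_eq_of_lt hr']
    simp only [this]

/-- length function from a guessing order -/
lemma aux_length {W : Type} [Fintype W] [Nonempty W] (e : Fin (Fintype.card W) ≃ W)
    (c : ℝ) (hc : c = ∑ i ∈ Finset.Icc 1 (Fintype.card W), (1 : ℝ) / i) :
    1 ≤ c ∧ ∃ L : W → ℕ, ∑ x, (2 : ℝ) ^ (-(L x : ℤ)) ≤ 1 ∧
      ∀ x, (2 : ℝ) ^ (L x) ≤ 2 * c * ((e.symm x : ℕ) + 1) := by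
  have hc1 : 1 ≤ c := by
    rw [hc]
    have : (1 : ℝ) / ((1 : ℕ) : ℝ) ≤ ∑ i ∈ Finset.Icc 1 (Fintype.card W), (1 : ℝ) / i :=
      Finset.single_le_sum (f := fun i : ℕ => (1 : ℝ) / i) (fun _ _ => by positivity)
        (Finset.mem_Icc.2 ⟨le_rfl, Fintype.card_pos⟩)
    simpa using this
  refine ⟨hc1, fun x => ⌈Real.logb 2 (c * ((e.symm x : ℕ) + 1))⌉₊, ?_, ?_⟩
  · have hx : ∀ x, (2 : ℝ) ^ (-((⌈Real.logb 2 (c * ((e.symm x : ℕ) + 1))⌉₊ : ℕ) : ℤ)) ≤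
        1 / c * (1 / ((e.symm x : ℕ) + 1)) := by
      intro x
      rw [zpow_neg, zpow_natCast, ← one_div, one_div_mul_one_div]
      refine one_div_le_one_div_of_le (by positivity) ?_
      rw [← Real.rpow_natCast, ← Real.logb_le_iff_le_rpow (by norm_num) (by positivity)]
      exact Nat.le_ceil _
    refine (Finset.sum_le_sum fun x _ => hx x).trans ?_
    rw [← Finset.mul_sum, ← e.sum_comp]
    simp only [Equiv.symm_apply_apply]
    rw [Fin.sum_univ_eq_sum_range (fun i => (1 : ℝ) / ((i : ℝ) + 1))]
    have : c = ∑ i ∈ Finset.range (Fintype.card W), (1 : ℝ) / ((i : ℝ) + 1) := by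
      rw [hc, Finset.range_eq_Ico, ← Finset.Ico_add_one_right_eq_Icc]
      rw [Finset.sum_Ico_eq_sum_range, Finset.sum_Ico_eq_sum_range]
      refine Finset.sum_congr (by simp) fun i _ => ?_
      push_cast; ring
    rw [← this]
    rw [one_div_mul_cancel (by positivity)]
  · intro x
    have hpos : 1 ≤ c * (((e.symm x : ℕ) : ℝ) + 1) := by
      have : (0 : ℝ) ≤ ((e.symm x : ℕ) : ℝ) := by positivity
      nlinarith
    have h1 := (Nat.ceil_lt_add_one (Real.logb_nonneg (by norm_num : (1:ℝ) < 2) hpos)).le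
    rw [← Real.rpow_natCast]
    refine (Real.rpow_le_rpow_of_exponent_le (by norm_num) h1).trans ?_
    rw [Real.rpow_add (by norm_num), Real.rpow_logb (by norm_num) (by norm_num) (by positivity),
      Real.rpow_one]
    linarith

/-!
STATEMENT 8: Shannon cipher system on message set `𝕏^n` with PMF `P`, key
uniform on a set of size `2^{nR}` (`nR = k ∈ ℕ`), `ρ > 0`. With
`E_n(R,ρ) = sup_{f_n} (1/n) log₂ (min over attack strategies G of E[G(X^n|Y)^ρ])`
and
`E_{n,l}(R,ρ) = min over length functions L_n of (1/n) log₂ E[(min{2^{L_n(X^n)}, 2^{nR}})^ρ]`,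
one has `|E_{n,l}(R,ρ) − E_n(R,ρ)| ≤ (1/n) log₂ (2^{2ρ} c_n^ρ (2+ρ))`, where
`c_n = ∑_{i=1}^{|𝕏|^n} 1/i`. (Cryptograms are taken, without loss of generality,
in `𝕏^n × 𝕂`.)
-/
theorem stmt_8 {𝕏 : Type} [Fintype 𝕏] [Nonempty 𝕏]
    (n : ℕ) (hn : 0 < n)
    (P : (Fin n → 𝕏) → ℝ) (hP0 : ∀ x, 0 ≤ P x) (hP1 : ∑ x : Fin n → 𝕏, P x = 1)
    (ρ R : ℝ) (hρ : 0 < ρ) (hR : 0 < R)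
    (k : ℕ) (hk : (k : ℝ) = n * R)
    (c : ℝ) (hc : c = ∑ i ∈ Finset.Icc 1 (Fintype.card (Fin n → 𝕏)), (1 : ℝ) / i)
    (En Enl : ℝ)
    (hEn : En = ⨆ f : {f : (Fin n → 𝕏) × Fin (2 ^ k) → (Fin n → 𝕏) × Fin (2 ^ k) //
        ∀ u, Function.Injective fun x => f (x, u)},
      (1 / (n : ℝ)) * Real.logb 2
        (⨅ G : {G : (Fin n → 𝕏) × Fin (2 ^ k) → (Fin n → 𝕏) → ℕ //
            (∀ y, Function.Injective (G y)) ∧ ∀ y x, 1 ≤ G y x},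
          ∑ x : Fin n → 𝕏, ∑ u : Fin (2 ^ k),
            P x * ((2 : ℝ) ^ k)⁻¹ * (G.1 (f.1 (x, u)) x : ℝ) ^ ρ))
    (hEnl : Enl = ⨅ L : {L : (Fin n → 𝕏) → ℕ //
        ∑ x : Fin n → 𝕏, (2 : ℝ) ^ (-(L x : ℤ)) ≤ 1},
      (1 / (n : ℝ)) * Real.logb 2
        (∑ x : Fin n → 𝕏, P x * (min ((2 : ℝ) ^ (L.1 x)) ((2 : ℝ) ^ k)) ^ ρ)) :
    |Enl - En| ≤ (1 / (n : ℝ)) * Real.logb 2 ((2 : ℝ) ^ (2 * ρ) * c ^ ρ * (2 + ρ)) := by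
  classical
  have hn' : (0 : ℝ) < n := by exact_mod_cast hn
  have hN : (0 : ℝ) ≤ 1 / (n : ℝ) := by positivity
  obtain ⟨e, f0, hf0, hG0⟩ := aux_encrypt k P hP0 ρ hρ
  obtain ⟨hc1, L0, hL0, hL0'⟩ := aux_length e c hc
  set B : ℝ := (2 : ℝ) ^ (2 * ρ) * c ^ ρ * (2 + ρ) with hB
  have h2ρ : (1 : ℝ) ≤ 2 ^ ρ := Real.one_le_rpow (by norm_num) hρ.le
  have hcρ : (1 : ℝ) ≤ c ^ ρ := Real.one_le_rpow hc1 hρ.le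
  have h22 : (2 : ℝ) ^ (2 * ρ) = 2 ^ ρ * 2 ^ ρ := by
    rw [two_mul, Real.rpow_add (by norm_num)]
  have hB2 : (2 : ℝ) ^ ρ * c ^ ρ * (2 + ρ) ≤ B := by
    rw [hB, h22]
    have : (0 : ℝ) ≤ (2 : ℝ) ^ ρ * c ^ ρ * (2 + ρ) := by positivity
    nlinarith
  have hB1 : (2 : ℝ) ^ ρ ≤ B := by
    refine le_trans ?_ hB2
    have : (1 : ℝ) ≤ c ^ ρ * (2 + ρ) := by nlinarith
    nlinarith
  have hBpos : 0 < B := by positivity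
  -- the compression cost is at least one
  have hV : ∀ L : (Fin n → 𝕏) → ℕ,
      1 ≤ ∑ x : Fin n → 𝕏, P x * (min ((2 : ℝ) ^ (L x)) ((2 : ℝ) ^ k)) ^ ρ := by
    intro L
    rw [← hP1]
    refine Finset.sum_le_sum fun x _ => ?_
    refine le_mul_of_one_le_right (hP0 x) (Real.one_le_rpow ?_ hρ.le)
    exact le_min (one_le_pow₀ (by norm_num)) (one_le_pow₀ (by norm_num))
  have hEG : ∀ (f : (Fin n → 𝕏) × Fin (2 ^ k) → (Fin n → 𝕏) × Fin (2 ^ k))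
      (G : (Fin n → 𝕏) × Fin (2 ^ k) → (Fin n → 𝕏) → ℕ), (∀ y x, 1 ≤ G y x) →
      1 ≤ ∑ x : Fin n → 𝕏, ∑ u : Fin (2 ^ k),
            P x * ((2 : ℝ) ^ k)⁻¹ * (G (f (x, u)) x : ℝ) ^ ρ := by
    intro f G hG
    rw [← hP1]
    refine Finset.sum_le_sum fun x _ => ?_
    have h1 : ∑ u : Fin (2 ^ k), P x * ((2 : ℝ) ^ k)⁻¹ = P x := by
      rw [Finset.sum_const, Finset.card_univ, Fintype.card_fin, nsmul_eq_mul]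
      push_cast
      field_simp
    rw [← h1]
    refine Finset.sum_le_sum fun u _ => ?_
    rw [h1]
    refine le_mul_of_one_le_right (mul_nonneg (hP0 x) (by positivity))
      (Real.one_le_rpow (by exact_mod_cast hG _ _) hρ.le)
  obtain ⟨Gx, hGx, -⟩ := aux_attack k f0 hf0 L0 hL0
  have : Nonempty {G : (Fin n → 𝕏) × Fin (2 ^ k) → (Fin n → 𝕏) → ℕ //
            (∀ y, Function.Injective (G y)) ∧ ∀ y x, 1 ≤ G y x} := ⟨⟨Gx, hGx⟩⟩
  have : Nonempty {f : (Fin n → 𝕏) × Fin (2 ^ k) → (Fin n → 𝕏) × Fin (2 ^ k) //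
        ∀ u, Function.Injective fun x => f (x, u)} := ⟨⟨f0, hf0⟩⟩
  have : Nonempty {L : (Fin n → 𝕏) → ℕ //
        ∑ x : Fin n → 𝕏, (2 : ℝ) ^ (-(L x : ℤ)) ≤ 1} := ⟨⟨L0, hL0⟩⟩
  rw [abs_le]
  constructor
  · suffices h : En - 1 / (n : ℝ) * Real.logb 2 B ≤ Enl by linarith
    rw [hEnl]
    refine le_ciInf fun L => ?_
    rw [sub_le_iff_le_add, hEn]
    refine ciSup_le fun f => ?_
    rw [← mul_add]
    refine mul_le_mul_of_nonneg_left ?_ hN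
    rw [← Real.logb_mul (by linarith [hV L.1]) hBpos.ne']
    refine Real.logb_le_logb_of_le (by norm_num) ?_ ?_
    · exact lt_of_lt_of_le one_pos (le_ciInf fun G => hEG f.1 G.1 G.2.2)
    · obtain ⟨G, hG, hGb⟩ := aux_attack k f.1 f.2 L.1 L.2
      refine (ciInf_le ⟨1, ?_⟩ (⟨G, hG⟩ : {G : (Fin n → 𝕏) × Fin (2 ^ k) → (Fin n → 𝕏) → ℕ //
            (∀ y, Function.Injective (G y)) ∧ ∀ y x, 1 ≤ G y x})).trans ?_
      · rintro _ ⟨G, rfl⟩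
        exact hEG f.1 G.1 G.2.2
      · have h1 : ∑ x : Fin n → 𝕏, ∑ u : Fin (2 ^ k),
            P x * ((2 : ℝ) ^ k)⁻¹ * (G (f.1 (x, u)) x : ℝ) ^ ρ ≤
            (∑ x : Fin n → 𝕏, P x * (min ((2 : ℝ) ^ (L.1 x)) ((2 : ℝ) ^ k)) ^ ρ) * 2 ^ ρ := by
          rw [Finset.sum_mul]
          refine Finset.sum_le_sum fun x _ => ?_
          have h2 : ∀ u : Fin (2 ^ k), P x * ((2 : ℝ) ^ k)⁻¹ * (G (f.1 (x, u)) x : ℝ) ^ ρ ≤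
              P x * ((2 : ℝ) ^ k)⁻¹ * (2 * min ((2 : ℝ) ^ (L.1 x)) ((2 : ℝ) ^ k)) ^ ρ := by
            intro u
            refine mul_le_mul_of_nonneg_left ?_ (mul_nonneg (hP0 x) (by positivity))
            refine Real.rpow_le_rpow (by positivity) ?_ hρ.le
            exact_mod_cast hGb x u
          refine (Finset.sum_le_sum fun u _ => h2 u).trans (le_of_eq ?_)
          rw [Finset.sum_const, Finset.card_univ, Fintype.card_fin, nsmul_eq_mul,
            Real.mul_rpow (by norm_num) (by positivity)]
          push_cast
          field_simp
        exact h1.trans (mul_le_mul_of_nonneg_left hB1 (by linarith [hV L.1]))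
  · suffices h : Enl ≤ En + 1 / (n : ℝ) * Real.logb 2 B by linarith
    have h1 : Enl ≤ (1 / (n : ℝ)) * Real.logb 2
        (∑ x : Fin n → 𝕏, P x * (min ((2 : ℝ) ^ (L0 x)) ((2 : ℝ) ^ k)) ^ ρ) := by
      rw [hEnl]
      refine ciInf_le ⟨0, ?_⟩ (⟨L0, hL0⟩ : {L : (Fin n → 𝕏) → ℕ //
        ∑ x : Fin n → 𝕏, (2 : ℝ) ^ (-(L x : ℤ)) ≤ 1})
      rintro _ ⟨L, rfl⟩
      exact mul_nonneg hN (Real.logb_nonneg (by norm_num) (hV L.1))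
    have h2 : (1 / (n : ℝ)) * Real.logb 2
        (⨅ G : {G : (Fin n → 𝕏) × Fin (2 ^ k) → (Fin n → 𝕏) → ℕ //
            (∀ y, Function.Injective (G y)) ∧ ∀ y x, 1 ≤ G y x},
          ∑ x : Fin n → 𝕏, ∑ u : Fin (2 ^ k),
            P x * ((2 : ℝ) ^ k)⁻¹ * (G.1 (f0 (x, u)) x : ℝ) ^ ρ) ≤ En := by
      rw [hEn]
      exact le_ciSup (f := fun f : {f : (Fin n → 𝕏) × Fin (2 ^ k) → (Fin n → 𝕏) × Fin (2 ^ k) //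
        ∀ u, Function.Injective fun x => f (x, u)} => (1 / (n : ℝ)) * Real.logb 2
        (⨅ G : {G : (Fin n → 𝕏) × Fin (2 ^ k) → (Fin n → 𝕏) → ℕ //
            (∀ y, Function.Injective (G y)) ∧ ∀ y x, 1 ≤ G y x},
          ∑ x : Fin n → 𝕏, ∑ u : Fin (2 ^ k),
            P x * ((2 : ℝ) ^ k)⁻¹ * (G.1 (f.1 (x, u)) x : ℝ) ^ ρ))
        (Set.finite_range _).bddAbove ⟨f0, hf0⟩
    refine h1.trans (le_trans ?_ (add_le_add_left h2 _))
    rw [← mul_add]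
    refine mul_le_mul_of_nonneg_left ?_ hN
    have hI : 1 ≤ ⨅ G : {G : (Fin n → 𝕏) × Fin (2 ^ k) → (Fin n → 𝕏) → ℕ //
            (∀ y, Function.Injective (G y)) ∧ ∀ y x, 1 ≤ G y x},
          ∑ x : Fin n → 𝕏, ∑ u : Fin (2 ^ k),
            P x * ((2 : ℝ) ^ k)⁻¹ * (G.1 (f0 (x, u)) x : ℝ) ^ ρ :=
      le_ciInf fun G => hEG f0 G.1 G.2.2
    rw [← Real.logb_mul (by linarith) hBpos.ne']
    refine Real.logb_le_logb_of_le (by norm_num) (by linarith [hV L0]) ?_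
    rw [← div_le_iff₀ hBpos]
    refine le_ciInf fun G => ?_
    rw [div_le_iff₀ hBpos]
    have h3 := hG0 G.1 G.2.1 G.2.2
    have h4 : ∑ x : Fin n → 𝕏, P x * (min ((2 : ℝ) ^ (L0 x)) ((2 : ℝ) ^ k)) ^ ρ ≤
        (2 ^ ρ * c ^ ρ) *
          ∑ x, P x * ((min ((e.symm x : ℕ) + 1) (2 ^ k) : ℕ) : ℝ) ^ ρ := by
      rw [Finset.mul_sum]
      refine Finset.sum_le_sum fun x _ => ?_
      have h5 : min ((2 : ℝ) ^ (L0 x)) ((2 : ℝ) ^ k) ≤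
          (2 * c) * ((min ((e.symm x : ℕ) + 1) (2 ^ k) : ℕ) : ℝ) := by
        push_cast
        rw [mul_min_of_nonneg _ _ (by linarith : 0 ≤ 2 * c)]
        refine min_le_min (hL0' x) ?_
        exact le_mul_of_one_le_left (by positivity) (by linarith)
      have h6 := Real.rpow_le_rpow (by positivity) h5 hρ.le
      rw [Real.mul_rpow (by linarith) (by positivity),
        Real.mul_rpow (by norm_num) (by linarith)] at h6
      calc _ ≤ P x * (2 ^ ρ * c ^ ρ * ((min ((e.symm x : ℕ) + 1) (2 ^ k) : ℕ) : ℝ) ^ ρ) :=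
            mul_le_mul_of_nonneg_left h6 (hP0 x)
        _ = _ := by ring
    have h7 := hEG f0 G.1 G.2.2
    calc _ ≤ _ := h4
      _ ≤ (2 ^ ρ * c ^ ρ) * ((2 + ρ) * _) := mul_le_mul_of_nonneg_left h3 (by positivity)
      _ = (2 ^ ρ * c ^ ρ * (2 + ρ)) * _ := by ring
      _ ≤ B * _ := mul_le_mul_of_nonneg_right hB2 (by linarith)
      _ = _ := mul_comm _ _
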